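/- The expected number of local level sets contained in a level set L(y), for y chosen uniformly at random from [0, 2/3], equals 3/2; equivalently, the Lebesgue integral ∫_{[0,2/3]} N^loc(y) dy = 1 (the lower Lebesgue integral with values in [0,∞]). -/

import Mathlib

open Set MeasureTheory ENNReal

/-- `phi x` is the distance from `x` to the nearest integer. -/
noncomputable def phi (x : ℝ) : ℝ := |x - (round x : ℤ)|

/-- The Takagi function. -/
noncomputable def T (x : ℝ) : ℝ := ∑' n : ℕ, phi (2 ^ n * x) / 2 ^ n

/-- The `n`-th binary digit of `x` (terminating expansion for dyadic rationals). -/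
noncomputable def eps (n : ℕ) (x : ℝ) : ℤ := ⌊2 ^ n * x⌋ - 2 * ⌊2 ^ (n - 1) * x⌋

/-- `D k x = ∑_{j=1}^k (-1)^{ε_j(x)}`, the excess of 0 digits over 1 digits. -/
noncomputable def D (k : ℕ) (x : ℝ) : ℤ := ∑ j ∈ Finset.Icc 1 k, (1 - 2 * eps j x)

/-- The level set of the Takagi function at level `y`. -/
def L (y : ℝ) : Set ℝ := {x | x ∈ Set.Icc (0:ℝ) 1 ∧ T x = y}

/-- `x` is a balanced dyadic rational of order `m`. -/
def BalancedOfOrder (x : ℝ) (m : ℕ) : Prop :=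
  x ∈ Set.Ico (0:ℝ) 1 ∧ (∃ k : ℤ, x = (k : ℝ) / 2 ^ (2 * m)) ∧ D (2 * m) x = 0

/-- The generation of a balanced dyadic rational of order `m`:
the number of indices `1 ≤ j ≤ 2m` with `D j x = 0`. -/
noncomputable def generation (x : ℝ) (m : ℕ) : ℕ :=
  ((Finset.Icc 1 (2 * m)).filter (fun j => D j x = 0)).card

/-- A balanced dyadic rational of order `m` is leading if `D j x ≥ 0` for all `1 ≤ j ≤ 2m`. -/
def Leading (x : ℝ) (m : ℕ) : Prop := ∀ j ∈ Finset.Icc 1 (2 * m), 0 ≤ D j x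

/-- The equivalence relation whose classes are the local level sets. -/
def locSetoid : Setoid ℝ where
  r x x' := ∀ n : ℕ, 1 ≤ n → |D n x| = |D n x'|
  iseqv := ⟨fun _ _ _ => rfl, fun h n hn => (h n hn).symm,
    fun h g n hn => (h n hn).trans (g n hn)⟩

/-- The set of local level sets contained in `L y`: the image of `L y ∩ [0,1)`
under the quotient map of `locSetoid`. -/
def locClasses (y : ℝ) : Set (Quotient locSetoid) :=
  Quotient.mk locSetoid '' (L y ∩ Set.Ico (0:ℝ) 1)

/-! ### The Takagi function -/

lemma phi_nonneg (x : ℝ) : 0 ≤ phi x := abs_nonneg _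

lemma phi_le_half (x : ℝ) : phi x ≤ 1 / 2 := abs_sub_round x

lemma phi_add_int (x : ℝ) (m : ℤ) : phi (x + m) = phi x := by
  simp only [phi, round_add_intCast]
  push_cast
  congr 1
  ring

lemma phi_eq_min {x : ℝ} (hx : x ∈ Ico (0:ℝ) 1) : phi x = min x (1 - x) := by
  rw [phi, abs_sub_round_eq_min, Int.fract_eq_self.2 hx]

lemma lipschitzWith_phi : LipschitzWith 1 phi := by
  refine LipschitzWith.of_le_add fun x y => ?_
  calc phi x ≤ |x - (round y : ℤ)| := round_le x _
    _ = |(y - (round y : ℤ)) + (x - y)| := by congr 1; ring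
    _ ≤ phi y + dist x y := abs_add_le _ _

lemma phi_term_le (x : ℝ) (n : ℕ) : phi (2 ^ n * x) / 2 ^ n ≤ 1 / 2 * (1 / 2) ^ n := by
  rw [div_eq_mul_one_div, one_div_pow]
  gcongr
  exact phi_le_half _

lemma summable_half_geometric : Summable fun n : ℕ => (1 / 2 * (1 / 2) ^ n : ℝ) :=
  (summable_geometric_of_lt_one (by norm_num) (by norm_num)).mul_left _

lemma summable_T (x : ℝ) : Summable fun n : ℕ => phi (2 ^ n * x) / 2 ^ n :=
  Summable.of_nonneg_of_le (fun _ => div_nonneg (phi_nonneg _) (by positivity))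
    (phi_term_le x) summable_half_geometric

lemma T_nonneg (x : ℝ) : 0 ≤ T x :=
  tsum_nonneg fun _ => div_nonneg (phi_nonneg _) (by positivity)

lemma T_le_one (x : ℝ) : T x ≤ 1 := by
  refine ((summable_T x).tsum_le_tsum (phi_term_le x) summable_half_geometric).trans ?_
  rw [tsum_mul_left, tsum_geometric_of_lt_one (by norm_num) (by norm_num)]
  norm_num

lemma continuous_T : Continuous T := by
  refine continuous_tsum (fun n => ?_) summable_half_geometric fun n x => ?_
  · exact (lipschitzWith_phi.continuous.comp (continuous_const.mul continuous_id)).div_const _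
  · rw [Real.norm_of_nonneg (div_nonneg (phi_nonneg _) (by positivity))]
    exact phi_term_le x n

lemma T_eq_phi_add (x : ℝ) : T x = phi x + T (2 * x) / 2 := by
  rw [T, (summable_T x).tsum_eq_zero_add, T, ← tsum_div_const]
  congr 1
  · simp
  · refine tsum_congr fun n => ?_
    rw [pow_succ, mul_assoc, div_div]

lemma T_add_int (x : ℝ) (m : ℤ) : T (x + m) = T x := by
  refine tsum_congr fun n => ?_
  have h : (2:ℝ) ^ n * (x + m) = 2 ^ n * x + ((2 ^ n * m : ℤ) : ℝ) := by push_cast; ring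
  rw [h, phi_add_int]

lemma phi_add_half_phi_le (x : ℝ) : phi x + phi (2 * x) / 2 ≤ 1 / 2 := by
  have h1 : phi x ≤ |x - (round x : ℤ)| := le_rfl
  have h2 : phi (2 * x) ≤ |2 * x - (2 * round x + 1 : ℤ)| := round_le _ _
  have h3 : phi (2 * x) ≤ |2 * x - (2 * round x - 1 : ℤ)| := round_le _ _
  have h4 := abs_le.1 (abs_sub_round x)
  push_cast at h2 h3
  rcases le_total 0 (x - (round x : ℤ)) with h | h
  · rw [abs_of_nonneg h] at h1
    rw [abs_of_nonpos (by linarith)] at h2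
    linarith
  · rw [abs_of_nonpos h] at h1
    rw [abs_of_nonneg (by linarith)] at h3
    linarith

lemma T_le_two_thirds (x : ℝ) : T x ≤ 2 / 3 := by
  have hb : BddAbove (range T) := ⟨1, by rintro _ ⟨x, rfl⟩; exact T_le_one x⟩
  have h : ⨆ x, T x ≤ 1 / 2 + (⨆ x, T x) / 4 := by
    refine ciSup_le fun x => ?_
    have h1 := T_eq_phi_add x
    have h2 := T_eq_phi_add (2 * x)
    have h3 := phi_add_half_phi_le x
    have h4 := le_ciSup hb (2 * (2 * x))
    linarith
  linarith [le_ciSup hb x]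

lemma T_zero : T 0 = 0 := by simp [T, phi]

lemma T_one : T 1 = 0 := by simpa [T_zero] using T_add_int 0 1

/-! ### Splitting off the first binary digit -/

lemma exists_first_digit {x : ℝ} (hx : x ∈ Ico (0:ℝ) 1) :
    ∃ (e : ℤ) (t : ℝ), (e = 0 ∨ e = 1) ∧ t ∈ Ico (0:ℝ) 1 ∧ x = (e + t) / 2 := by
  obtain ⟨h0, h1⟩ := hx
  rcases lt_or_ge x (1 / 2) with h | h
  · exact ⟨0, 2 * x, .inl rfl, ⟨by linarith, by linarith⟩, by push_cast; ring⟩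
  · exact ⟨1, 2 * x - 1, .inr rfl, ⟨by linarith, by linarith⟩, by push_cast; ring⟩

lemma half_digit_add_mem_Ico {e : ℤ} (he : e = 0 ∨ e = 1) {t : ℝ} (ht : t ∈ Ico (0:ℝ) 1) :
    ((e + t) / 2 : ℝ) ∈ Ico (0:ℝ) 1 := by
  obtain ⟨h0, h1⟩ := ht
  rcases he with rfl | rfl <;> push_cast <;> constructor <;> linarith

lemma T_half_digit_add {e : ℤ} (he : e = 0 ∨ e = 1) {t : ℝ} (ht : t ∈ Ico (0:ℝ) 1) :
    T ((e + t) / 2) = (e + (1 - 2 * e) * t) / 2 + T t / 2 := by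
  rw [T_eq_phi_add, phi_eq_min (half_digit_add_mem_Ico he ht),
    show (2:ℝ) * ((e + t) / 2) = t + e by ring, T_add_int]
  obtain ⟨h0, h1⟩ := ht
  congr 1
  rcases he with rfl | rfl <;> push_cast
  · rw [min_eq_left (by linarith)]; ring
  · rw [min_eq_right (by linarith)]; ring

lemma D_zero (x : ℝ) : D 0 x = 0 := by simp [D]

lemma D_eq_sum_range (n : ℕ) (x : ℝ) :
    D n x = ∑ j ∈ Finset.range n, (1 - 2 * eps (j + 1) x) := by
  rw [D, Finset.range_eq_Ico, Finset.sum_Ico_add' (fun j => 1 - 2 * eps j x) 0 n 1]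
  rfl

lemma D_succ (n : ℕ) (x : ℝ) : D (n + 1) x = D n x + (1 - 2 * eps (n + 1) x) := by
  simp only [D_eq_sum_range, Finset.sum_range_succ]

lemma D_half_digit_add {e : ℤ} (he : e = 0 ∨ e = 1) {t : ℝ} (ht : t ∈ Ico (0:ℝ) 1) (n : ℕ) :
    D (n + 1) ((e + t) / 2) = (1 - 2 * e) + D n t := by
  rw [D_eq_sum_range, Finset.sum_range_succ', add_comm, D_eq_sum_range]
  congr 1
  · have h1 : ⌊((e:ℝ) + t) / 2⌋ = 0 := Int.floor_eq_zero_iff.2 (half_digit_add_mem_Ico he ht)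
    have h2 : ⌊t⌋ = 0 := Int.floor_eq_zero_iff.2 ht
    simp [eps, h1, h2, mul_div_cancel₀]
  · refine Finset.sum_congr rfl fun j _ => ?_
    have h1 : (2:ℝ) ^ (j + 1 + 1) * ((e + t) / 2) = 2 ^ (j + 1) * t + ((2 ^ (j + 1) * e : ℤ) : ℝ) := by
      push_cast; ring
    have h2 : (2:ℝ) ^ (j + 1) * ((e + t) / 2) = 2 ^ j * t + ((2 ^ j * e : ℤ) : ℝ) := by
      push_cast; ring
    simp only [eps, Nat.add_sub_cancel, h1, h2, Int.floor_add_intCast]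
    ring

lemma eps_succ_eq_zero_or_one (n : ℕ) (x : ℝ) : eps (n + 1) x = 0 ∨ eps (n + 1) x = 1 := by
  have h : (2:ℝ) ^ (n + 1) * x = 2 * (2 ^ n * x) := by ring
  have h1 := Int.floor_le ((2:ℝ) ^ n * x)
  have h2 := Int.lt_floor_add_one ((2:ℝ) ^ n * x)
  have h3 : 2 * ⌊(2:ℝ) ^ n * x⌋ ≤ ⌊(2:ℝ) ^ (n + 1) * x⌋ := Int.le_floor.2 (by push_cast; linarith)
  have h4 : ⌊(2:ℝ) ^ (n + 1) * x⌋ < 2 * ⌊(2:ℝ) ^ n * x⌋ + 2 := Int.floor_lt.2 (by push_cast; linarith)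
  simp only [eps, Nat.add_sub_cancel]
  omega

lemma eq_of_D_eq {x x' : ℝ} (hx : x ∈ Ico (0:ℝ) 1) (hx' : x' ∈ Ico (0:ℝ) 1)
    (h : ∀ n, D n x = D n x') : x = x' := by
  have key : ∀ n : ℕ, ∀ x ∈ Ico (0:ℝ) 1, ∀ x' ∈ Ico (0:ℝ) 1, (∀ n, D n x = D n x') →
      |x - x'| ≤ (1 / 2) ^ n := by
    intro n
    induction n with
    | zero =>
      rintro x ⟨h0, h1⟩ x' ⟨h0', h1'⟩ -
      rw [pow_zero, abs_le]
      constructor <;> linarith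
    | succ n ih =>
      intro x hx x' hx' h
      obtain ⟨e, t, he, ht, rfl⟩ := exists_first_digit hx
      obtain ⟨e', t', he', ht', rfl⟩ := exists_first_digit hx'
      have hee : e = e' := by
        have := h 1
        rw [D_half_digit_add he ht 0, D_half_digit_add he' ht' 0, D_zero, D_zero] at this
        omega
      subst hee
      have := ih t ht t' ht' fun n => by
        have := h (n + 1)
        rw [D_half_digit_add he ht, D_half_digit_add he ht'] at this
        omega
      rw [show (((e:ℝ) + t) / 2 - (e + t') / 2) = (t - t') / 2 by ring, abs_div, abs_two, pow_succ]
      linarith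
  have hlim := ge_of_tendsto' (tendsto_pow_atTop_nhds_zero_of_lt_one
    (by norm_num : (0:ℝ) ≤ 1 / 2) (by norm_num)) fun n => key n x hx x' hx' h
  exact sub_eq_zero.1 (abs_eq_zero.1 (le_antisymm hlim (abs_nonneg _)))

/-! ### Reflecting walks at zero -/

/-- The tilted Takagi function depends only on the absolute values of the tilted digit walk. -/
lemma T_add_eq_of_abs_D_eq {d : ℤ} {x x' : ℝ} (hx : x ∈ Ico (0:ℝ) 1) (hx' : x' ∈ Ico (0:ℝ) 1)
    (h : ∀ n, |d + D n x| = |d + D n x'|) : T x + d * x = T x' + d * x' := by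
  have key : ∀ n : ℕ, ∀ d d' : ℤ, ∀ x ∈ Ico (0:ℝ) 1, ∀ x' ∈ Ico (0:ℝ) 1,
      (∀ n, |d + D n x| = |d' + D n x'|) →
      |(T x + d * (x - 1 / 2)) - (T x' + d' * (x' - 1 / 2))| ≤ (2 + |(d:ℝ)| + n) * (1 / 2) ^ n := by
    intro n
    induction n with
    | zero =>
      rintro d d' x ⟨h0, h1⟩ x' ⟨h0', h1'⟩ h
      have hd : |(d:ℝ)| = |(d':ℝ)| := by exact_mod_cast (by simpa [D_zero] using h 0 : |d| = |d'|)
      have hb : ∀ (d : ℤ) (x : ℝ), 0 ≤ x → x < 1 → |T x + d * (x - 1 / 2)| ≤ 1 + |(d:ℝ)| / 2 := by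
        intro d x h0 h1
        refine (abs_add_le _ _).trans (add_le_add ?_ ?_)
        · rw [abs_of_nonneg (T_nonneg x)]; exact T_le_one x
        · have hx : |x - 1 / 2| ≤ 1 / 2 := abs_le.2 ⟨by linarith, by linarith⟩
          rw [abs_mul]
          linarith [mul_le_mul_of_nonneg_left hx (abs_nonneg (d:ℝ))]
      have := abs_sub (T x + d * (x - 1 / 2)) (T x' + d' * (x' - 1 / 2))
      have h3 := hb d x h0 h1
      have h4 := hb d' x' h0' h1'
      simp only [Nat.cast_zero, pow_zero]
      linarith
    | succ n ih =>
      intro d d' x hx x' hx' h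
      obtain ⟨e, t, he, ht, rfl⟩ := exists_first_digit hx
      obtain ⟨e', t', he', ht', rfl⟩ := exists_first_digit hx'
      have h0 : |d| = |d'| := by simpa [D_zero] using h 0
      have h1 : |d + (1 - 2 * e)| = |d' + (1 - 2 * e')| := by
        simpa [D_half_digit_add he ht 0, D_half_digit_add he' ht' 0, D_zero] using h 1
      have hn := ih (d + (1 - 2 * e)) (d' + (1 - 2 * e')) t ht t' ht' fun n => by
        simpa [D_half_digit_add he ht n, D_half_digit_add he' ht' n, add_assoc] using h (n + 1)
      have heven : (1 - 2 * e) * d = (1 - 2 * e') * d' := by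
        have hs := sq_eq_sq_iff_abs_eq_abs _ _ |>.2 h0
        have hs' := sq_eq_sq_iff_abs_eq_abs _ _ |>.2 h1
        have q : (1 - 2 * e) ^ 2 = 1 := by rcases he with rfl | rfl <;> norm_num
        have q' : (1 - 2 * e') ^ 2 = 1 := by rcases he' with rfl | rfl <;> norm_num
        nlinarith
      have hevenR : (1 - 2 * (e:ℝ)) * d = (1 - 2 * e') * d' := by exact_mod_cast heven
      have hsplit : ∀ (d e : ℤ) (t : ℝ), (e = 0 ∨ e = 1) → t ∈ Ico (0:ℝ) 1 →
          T ((e + t) / 2) + d * ((e + t) / 2 - 1 / 2) =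
            (T t + (d + (1 - 2 * e) : ℤ) * (t - 1 / 2)) / 2 + (1 - (1 - 2 * e) * d) / 4 := by
        intro d e t he ht
        rw [T_half_digit_add he ht]
        push_cast
        ring
      rw [hsplit d e t he ht, hsplit d' e' t' he' ht', hevenR]
      have hd : |((d + (1 - 2 * e) : ℤ) : ℝ)| ≤ |(d:ℝ)| + 1 := by
        push_cast
        refine (abs_add_le _ _).trans (add_le_add le_rfl ?_)
        rcases he with rfl | rfl <;> norm_num
      have hp : (0:ℝ) < (1 / 2) ^ n := by positivity
      rw [add_sub_add_right_eq_sub, ← sub_div, abs_div, abs_two, pow_succ]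
      push_cast at hn hd ⊢
      nlinarith
  have hlim : Filter.Tendsto (fun n : ℕ => (2 + |(d:ℝ)| + n) * (1 / 2 : ℝ) ^ n) Filter.atTop
      (nhds 0) := by
    have h1 := (tendsto_pow_atTop_nhds_zero_of_lt_one
      (by norm_num : (0:ℝ) ≤ 1 / 2) (by norm_num)).const_mul (2 + |(d:ℝ)|)
    have h2 := tendsto_self_mul_const_pow_of_lt_one (by norm_num : (0:ℝ) ≤ 1 / 2) (by norm_num)
    simpa [add_mul] using h1.add h2
  have h0 := ge_of_tendsto' hlim fun n => key n d d x hx x' hx' h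
  have := abs_eq_zero.1 (le_antisymm h0 (abs_nonneg _))
  linarith

lemma ofDigits_two_eq (a : ℕ → Fin 2) :
    Real.ofDigits a = (((a 0 : ℕ) : ℤ) + Real.ofDigits fun i => a (i + 1)) / 2 := by
  have := Real.ofDigits_eq_sum_add_ofDigits a 1
  simp only [Finset.sum_range_one, Real.ofDigitsTerm] at this ⊢
  rw [this]
  push_cast
  ring

lemma ofDigits_two_lt_one {k : ℕ} {a : ℕ → Fin 2} (hk : a k = 0) : Real.ofDigits a < 1 := by
  induction k generalizing a with
  | zero =>
    rw [ofDigits_two_eq, hk]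
    have := Real.ofDigits_le_one fun i => a (i + 1)
    norm_num
    linarith
  | succ k ih =>
    rw [ofDigits_two_eq]
    have h1 := ih (a := fun i => a (i + 1)) hk
    have h2 : (((a 0 : ℕ) : ℤ) : ℝ) ≤ 1 := by exact_mod_cast Nat.lt_succ_iff.1 (a 0).2
    linarith

lemma D_ofDigits_two {a : ℕ → Fin 2} (ha : ∀ n, ∃ k ≥ n, a k = 0) (n : ℕ) :
    D n (Real.ofDigits a) = ∑ j ∈ Finset.range n, (1 - 2 * ((a j : ℕ) : ℤ)) := by
  induction n generalizing a with
  | zero => simp [D_zero]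
  | succ n ih =>
    have ha' : ∀ n, ∃ k ≥ n, a (k + 1) = 0 := fun n => by
      obtain ⟨k, hk, h⟩ := ha (n + 1)
      exact ⟨k - 1, by omega, by rwa [Nat.sub_add_cancel (by omega)]⟩
    obtain ⟨k, -, hk⟩ := ha' 0
    have he : ((a 0 : ℕ) : ℤ) = 0 ∨ ((a 0 : ℕ) : ℤ) = 1 := by have := (a 0).2; omega
    rw [ofDigits_two_eq, D_half_digit_add he
      ⟨Real.ofDigits_nonneg _, ofDigits_two_lt_one (a := fun i => a (i + 1)) hk⟩, ih ha',
      Finset.sum_range_succ', add_comm]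

lemma exists_D_eq_abs {d : ℤ} (hd : 0 ≤ d) (x : ℝ) :
    ∃ x' ∈ Ico (0:ℝ) 1, ∀ n, d + D n x' = |d + D n x| := by
  classical
  set E : ℕ → ℤ := fun n => |d + D n x| with hE
  have hstep : ∀ n, E (n + 1) = E n + 1 ∨ E (n + 1) = E n - 1 := by
    intro n
    simp only [hE, D_succ]
    rcases eps_succ_eq_zero_or_one n x with h | h <;> rw [h] <;>
      rcases abs_cases (d + D n x) with h1 | h1 <;>
      rcases abs_cases (d + D n x + 1) with h2 | h2 <;>
      rcases abs_cases (d + D n x - 1) with h3 | h3 <;> grind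
  let a : ℕ → Fin 2 := fun n => if E (n + 1) = E n + 1 then 0 else 1
  have hstep' : ∀ n, 1 - 2 * ((a n : ℕ) : ℤ) = E (n + 1) - E n := by
    intro n
    by_cases h : E (n + 1) = E n + 1
    · simp [a, h]
    · have := (hstep n).resolve_left h
      have h1 : a n = 1 := if_neg h
      rw [h1, this]
      norm_num
  have ha : ∀ n, ∃ k ≥ n, a k = 0 := by
    intro n
    by_contra! hcon
    have hdec : ∀ m : ℕ, E (n + m) = E n - m := by
      intro m
      induction m with
      | zero => simp
      | succ m ih =>
        have h1 : a (n + m) = 1 := by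
          have := hcon (n + m) (by omega)
          omega
        have := hstep' (n + m)
        rw [h1] at this
        push_cast at this ⊢
        rw [← add_assoc]
        norm_num at this
        omega
    have h1 := hdec (E n + 1).toNat
    have h2 : 0 ≤ E n := abs_nonneg _
    have h3 : 0 ≤ E (n + (E n + 1).toNat) := abs_nonneg _
    omega
  obtain ⟨k, -, hk⟩ := ha 0
  refine ⟨Real.ofDigits a, ⟨Real.ofDigits_nonneg _, ofDigits_two_lt_one hk⟩, fun n => ?_⟩
  rw [D_ofDigits_two ha, Finset.sum_congr rfl fun j _ => hstep' j, Finset.sum_range_sub]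
  simp [hE, D_zero, abs_of_nonneg hd]

/-! ### Counting solutions along nonnegative walks -/

/-- Points of `[0,1)` whose digit walk started at `d` stays nonnegative. -/
def nonnegWalk (d : ℤ) : Set ℝ := {x | x ∈ Ico (0:ℝ) 1 ∧ ∀ n, 0 ≤ d + D n x}

/-- Solutions of `T x + d * x = y` among points whose digit walk started at `d` stays
nonnegative. -/
def tiltedSol (d : ℤ) (y : ℝ) : Set ℝ := {x | x ∈ nonnegWalk d ∧ T x + d * x = y}

lemma nonnegWalk_of_neg {d : ℤ} (hd : d < 0) : nonnegWalk d = ∅ := by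
  refine eq_empty_of_forall_notMem fun x hx => ?_
  have := hx.2 0
  rw [D_zero] at this
  omega

lemma tiltedSol_of_neg {d : ℤ} (hd : d < 0) (y : ℝ) : tiltedSol d y = ∅ := by
  simp [tiltedSol, nonnegWalk_of_neg hd]

lemma exists_mem_nonnegWalk {d : ℤ} (hd : 0 ≤ d) {x : ℝ} (hx : x ∈ Ico (0:ℝ) 1) :
    ∃ x' ∈ nonnegWalk d, (∀ n, |d + D n x'| = |d + D n x|) ∧ T x' + d * x' = T x + d * x := by
  obtain ⟨x', hx', h⟩ := exists_D_eq_abs hd x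
  have habs : ∀ n, |d + D n x'| = |d + D n x| := fun n => by rw [h, abs_abs]
  exact ⟨x', ⟨hx', fun n => by rw [h]; exact abs_nonneg _⟩, habs,
    T_add_eq_of_abs_D_eq hx' hx habs⟩

lemma encard_locClasses (y : ℝ) : (locClasses y).encard = (tiltedSol 0 y).encard := by
  have himg : locClasses y = Quotient.mk locSetoid '' tiltedSol 0 y := by
    apply Subset.antisymm
    · rintro _ ⟨x, ⟨⟨-, hT⟩, hx⟩, rfl⟩
      obtain ⟨x', hx', habs, hT'⟩ := exists_mem_nonnegWalk le_rfl hx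
      refine ⟨x', ⟨hx', by simpa [hT] using hT'⟩, Quotient.sound fun n _ => ?_⟩
      simpa using habs n
    · rintro _ ⟨x, ⟨hx, hT⟩, rfl⟩
      exact ⟨x, ⟨⟨Ico_subset_Icc_self hx.1, by simpa using hT⟩, hx.1⟩, rfl⟩
  rw [himg, InjOn.encard_image]
  rintro x ⟨hx, -⟩ x' ⟨hx', -⟩ h
  refine eq_of_D_eq hx.1 hx'.1 fun n => ?_
  rcases n.eq_zero_or_pos with rfl | hn
  · simp [D_zero]
  · have h1 := Quotient.exact h n hn
    have h2 := hx.2 n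
    have h3 := hx'.2 n
    rw [zero_add] at h2 h3
    rwa [abs_of_nonneg h2, abs_of_nonneg h3] at h1

lemma half_digit_add_mem_nonnegWalk_iff {d e : ℤ} (hd : 0 ≤ d) (he : e = 0 ∨ e = 1) {t : ℝ}
    (ht : t ∈ Ico (0:ℝ) 1) :
    ((e + t) / 2 : ℝ) ∈ nonnegWalk d ↔ t ∈ nonnegWalk (d + (1 - 2 * e)) := by
  constructor
  · rintro ⟨-, h⟩
    refine ⟨ht, fun n => ?_⟩
    rw [add_assoc, ← D_half_digit_add he ht]
    exact h (n + 1)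
  · rintro ⟨-, h⟩
    refine ⟨half_digit_add_mem_Ico he ht, fun n => ?_⟩
    cases n with
    | zero => rwa [D_zero, add_zero]
    | succ n =>
      rw [D_half_digit_add he ht, ← add_assoc]
      exact h n

lemma half_digit_add_mem_tiltedSol_iff {d e : ℤ} (hd : 0 ≤ d) (he : e = 0 ∨ e = 1) {t y : ℝ}
    (ht : t ∈ Ico (0:ℝ) 1) :
    ((e + t) / 2 : ℝ) ∈ tiltedSol d y ↔
      t ∈ tiltedSol (d + (1 - 2 * e)) (2 * y - e * (d + 1)) := by
  simp only [tiltedSol, mem_ofPred_eq, half_digit_add_mem_nonnegWalk_iff hd he ht,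
    T_half_digit_add he ht]
  refine and_congr_right fun _ => ?_
  push_cast
  constructor <;> intro h <;> linarith

lemma tiltedSol_eq_union {d : ℤ} (hd : 0 ≤ d) (y : ℝ) :
    tiltedSol d y = (fun t => t / 2) '' tiltedSol (d + 1) (2 * y) ∪
      (fun t => (1 + t) / 2) '' tiltedSol (d - 1) (2 * y - (d + 1)) := by
  have h0 : ∀ t ∈ Ico (0:ℝ) 1, (t / 2 ∈ tiltedSol d y ↔ t ∈ tiltedSol (d + 1) (2 * y)) := by
    intro t ht
    simpa using half_digit_add_mem_tiltedSol_iff (y := y) hd (.inl rfl) ht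
  have h1 : ∀ t ∈ Ico (0:ℝ) 1,
      ((1 + t) / 2 ∈ tiltedSol d y ↔ t ∈ tiltedSol (d - 1) (2 * y - (d + 1))) := by
    intro t ht
    simpa [sub_eq_add_neg] using half_digit_add_mem_tiltedSol_iff (y := y) hd (.inr rfl) ht
  apply Subset.antisymm
  · intro x hx
    obtain ⟨e, t, rfl | rfl, ht, rfl⟩ := exists_first_digit hx.1.1
    · left
      rw [Int.cast_zero, zero_add] at hx ⊢
      exact ⟨t, (h0 t ht).1 hx, rfl⟩
    · right
      rw [Int.cast_one] at hx ⊢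
      exact ⟨t, (h1 t ht).1 hx, rfl⟩
  · rintro _ (⟨t, ht, rfl⟩ | ⟨t, ht, rfl⟩)
    · exact (h0 t ht.1.1).2 ht
    · exact (h1 t ht.1.1).2 ht

/-- The number of solutions counted by `tiltedSol`. -/
noncomputable def solCount (d : ℤ) (y : ℝ) : ℝ≥0∞ := ((tiltedSol d y).encard : ℝ≥0∞)

lemma solCount_of_neg {d : ℤ} (hd : d < 0) (y : ℝ) : solCount d y = 0 := by
  simp [solCount, tiltedSol_of_neg hd]

lemma solCount_eq_add {d : ℤ} (hd : 0 ≤ d) (y : ℝ) :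
    solCount d y = solCount (d + 1) (2 * y) + solCount (d - 1) (2 * y - (d + 1)) := by
  have hdisj : Disjoint ((fun t => t / 2) '' tiltedSol (d + 1) (2 * y))
      ((fun t => (1 + t) / 2) '' tiltedSol (d - 1) (2 * y - (d + 1))) := by
    rw [Set.disjoint_left]
    rintro _ ⟨t, ht, rfl⟩ ⟨t', ht', h⟩
    have h1 := ht.1.1.2
    have h2 := ht'.1.1.1
    simp only at h
    linarith
  simp only [solCount]
  rw [tiltedSol_eq_union hd, encard_union_eq hdisj, ENat.toENNReal_add,
    Function.Injective.encard_image (f := fun t : ℝ => t / 2) (fun a b h => by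
      simp only at h; linarith),
    Function.Injective.encard_image (f := fun t : ℝ => (1 + t) / 2) (fun a b h => by
      simp only at h; linarith)]

open Classical in
/-- The number of dyadic intervals of length `2⁻ⁿ` containing a point of `tiltedSol d y`. -/
noncomputable def boxCount : ℕ → ℤ → ℝ → ℝ≥0∞
  | 0, d, y => if (tiltedSol d y).Nonempty then 1 else 0
  | n + 1, d, y => if d < 0 then 0 else
      boxCount n (d + 1) (2 * y) + boxCount n (d - 1) (2 * y - (d + 1))

lemma boxCount_le_solCount (n : ℕ) (d : ℤ) (y : ℝ) : boxCount n d y ≤ solCount d y := by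
  induction n generalizing d y with
  | zero =>
    rw [boxCount]
    split_ifs with h
    · rw [solCount, ← ENat.toENNReal_one, ENat.toENNReal_le]
      exact one_le_encard_iff_nonempty.2 h
    · exact zero_le
  | succ n ih =>
    rw [boxCount]
    split_ifs with h
    · exact zero_le
    · rw [solCount_eq_add (not_lt.1 h)]
      exact add_le_add (ih _ _) (ih _ _)

lemma encard_le_boxCount (n : ℕ) (d : ℤ) (y : ℝ) {S : Set ℝ} (hS : S ⊆ tiltedSol d y)
    (hsep : S.Pairwise fun x x' => (1 / 2 : ℝ) ^ n ≤ |x - x'|) :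
    (S.encard : ℝ≥0∞) ≤ boxCount n d y := by
  induction n generalizing d y S with
  | zero =>
    rw [boxCount]
    have hsub : S.Subsingleton := by
      intro x hx x' hx'
      by_contra hne
      have h := hsep hx hx' hne
      obtain ⟨h0, h1⟩ := (hS hx).1.1
      obtain ⟨h0', h1'⟩ := (hS hx').1.1
      rw [pow_zero, le_abs] at h
      rcases h with h | h <;> linarith
    split_ifs with h
    · rw [← ENat.toENNReal_one, ENat.toENNReal_le]
      exact encard_le_one_iff_subsingleton.2 hsub
    · rw [not_nonempty_iff_eq_empty] at h
      simp [subset_empty_iff.1 (h ▸ hS)]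
  | succ n ih =>
    rw [boxCount]
    split_ifs with h
    · rw [tiltedSol_of_neg h, subset_empty_iff] at hS
      simp [hS]
    have hd := not_lt.1 h
    set S₀ := (fun t : ℝ => t / 2) ⁻¹' S ∩ Ico 0 1
    set S₁ := (fun t : ℝ => (1 + t) / 2) ⁻¹' S ∩ Ico 0 1
    have h0 := ih (d + 1) (2 * y) (S := S₀)
      (fun t ht => by
        simpa using (half_digit_add_mem_tiltedSol_iff (y := y) hd (.inl rfl) ht.2).1
          (by simpa using hS ht.1))
      (fun t ht t' ht' hne => by
        have := hsep ht.1 ht'.1 (fun h => hne (by linarith))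
        simp only [← sub_div, abs_div, abs_two, pow_succ] at this ⊢
        linarith)
    have h1 := ih (d - 1) (2 * y - (d + 1)) (S := S₁)
      (fun t ht => by
        simpa [sub_eq_add_neg] using
          (half_digit_add_mem_tiltedSol_iff (y := y) hd (.inr rfl) ht.2).1
          (by simpa using hS ht.1))
      (fun t ht t' ht' hne => by
        have := hsep ht.1 ht'.1 (fun h => hne (by linarith))
        simp only [← sub_div, add_sub_add_left_eq_sub, abs_div, abs_two, pow_succ] at this ⊢
        linarith)
    refine le_trans ?_ (add_le_add h0 h1)
    rw [← ENat.toENNReal_add, ENat.toENNReal_le]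
    have hcov : S ⊆ (fun t : ℝ => t / 2) '' S₀ ∪ (fun t : ℝ => (1 + t) / 2) '' S₁ := by
      intro x hx
      obtain ⟨e, t, rfl | rfl, ht, rfl⟩ := exists_first_digit (hS hx).1.1
      · rw [Int.cast_zero, zero_add] at hx ⊢
        exact .inl ⟨t, ⟨hx, ht⟩, rfl⟩
      · rw [Int.cast_one] at hx ⊢
        exact .inr ⟨t, ⟨hx, ht⟩, rfl⟩
    exact (encard_le_encard hcov).trans ((encard_union_le _ _).trans
      (add_le_add (encard_image_le _ _) (encard_image_le _ _)))

lemma Set.Finite.eventually_pairwise_pow_le_abs_sub {S : Set ℝ} (hS : S.Finite) :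
    ∀ᶠ n : ℕ in Filter.atTop, S.Pairwise fun x x' => (1 / 2 : ℝ) ^ n ≤ |x - x'| := by
  have h : ∀ x ∈ S, ∀ᶠ n : ℕ in Filter.atTop, ∀ x' ∈ S, x ≠ x' → (1 / 2 : ℝ) ^ n ≤ |x - x'| := by
    intro x _
    refine (Filter.eventually_all_finite hS).2 fun x' _ => ?_
    rcases eq_or_ne x x' with rfl | hne
    · simp
    · filter_upwards [(tendsto_pow_atTop_nhds_zero_of_lt_one (by norm_num : (0:ℝ) ≤ 1 / 2)
        (by norm_num)).eventually_le_const (abs_pos.2 (sub_ne_zero.2 hne))] with n hn _ using hn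
  filter_upwards [(Filter.eventually_all_finite hS).2 h] with n hn x hx x' hx' using hn x hx x' hx'

lemma solCount_eq_liminf (d : ℤ) (y : ℝ) :
    solCount d y = Filter.liminf (fun n => boxCount n d y) Filter.atTop := by
  apply le_antisymm
  · have hfin : ∀ S ⊆ tiltedSol d y, S.Finite →
        (S.encard : ℝ≥0∞) ≤ Filter.liminf (fun n => boxCount n d y) Filter.atTop := by
      intro S hS hfin
      refine Filter.le_liminf_of_le (by isBoundedDefault) ?_
      filter_upwards [hfin.eventually_pairwise_pow_le_abs_sub] with n hn
      exact encard_le_boxCount n d y hS hn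
    rcases (tiltedSol d y).finite_or_infinite with h | h
    · exact hfin _ Subset.rfl h
    · refine le_of_le_of_eq le_top (Eq.symm (ENNReal.eq_top_of_forall_nnreal_le fun r => ?_))
      obtain ⟨k, hk⟩ := exists_nat_ge r
      obtain ⟨S, hS, hcard⟩ := exists_subset_encard_eq (s := tiltedSol d y) (k := k)
        (by simp [h.encard_eq])
      have := hfin S hS (finite_of_encard_eq_coe hcard)
      rw [hcard, ENat.toENNReal_coe] at this
      exact le_trans (by exact_mod_cast hk) this
  · refine Filter.liminf_le_of_le (by isBoundedDefault) fun b hb => ?_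
    obtain ⟨n, hn⟩ := hb.exists
    exact hn.trans (boxCount_le_solCount n d y)

/-! ### Integrating the counts -/

lemma tiltedSol_nonempty_iff {d : ℤ} (hd : 0 ≤ d) (y : ℝ) :
    (tiltedSol d y).Nonempty ↔ y ∈ (fun x => T x + d * x) '' Ico (0:ℝ) 1 := by
  constructor
  · rintro ⟨x, hx, rfl⟩
    exact ⟨x, hx.1, rfl⟩
  · rintro ⟨x, hx, rfl⟩
    obtain ⟨x', hx', -, h⟩ := exists_mem_nonnegWalk hd hx
    exact ⟨x', hx', h⟩

lemma continuous_T_add (d : ℤ) : Continuous fun x => T x + d * x :=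
  continuous_T.add (continuous_const.mul continuous_id)

lemma measurable_boxCount (n : ℕ) (d : ℤ) : Measurable (boxCount n d) := by
  classical
  induction n generalizing d with
  | zero =>
    refine Measurable.ite ?_ measurable_const measurable_const
    rcases lt_or_ge d 0 with hd | hd
    · simp [tiltedSol_of_neg hd]
    · simp only [tiltedSol_nonempty_iff hd]
      exact (isPreconnected_Ico.image _
        (continuous_T_add d).continuousOn).ordConnected.measurableSet
  | succ n ih =>
    by_cases h : d < 0
    · simp only [funext (fun y => show boxCount (n + 1) d y = 0 by rw [boxCount, if_pos h])]
      exact measurable_const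
    · have : boxCount (n + 1) d = fun y => boxCount n (d + 1) (2 * y) +
          boxCount n (d - 1) (2 * y - (d + 1)) := by
        funext y
        rw [boxCount, if_neg h]
      rw [this]
      exact ((ih _).comp (by fun_prop)).add ((ih _).comp (by fun_prop))

lemma measurable_solCount (d : ℤ) : Measurable (solCount d) := by
  rw [funext (solCount_eq_liminf d)]
  exact Measurable.liminf fun n => measurable_boxCount n d

lemma lintegral_comp_two_mul (f : ℝ → ℝ≥0∞) : ∫⁻ y, f (2 * y) = 2⁻¹ * ∫⁻ y, f y := by
  have h := lintegral_map_equiv f (Homeomorph.mulLeft₀ (2:ℝ) two_ne_zero).toMeasurableEquiv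
    (μ := volume)
  simp only [Homeomorph.toMeasurableEquiv_coe, Homeomorph.coe_mulLeft₀] at h
  rw [← h, Real.map_volume_mul_left two_ne_zero, lintegral_smul_measure, abs_of_pos (by norm_num),
    ENNReal.ofReal_inv_of_pos two_pos, ENNReal.ofReal_ofNat, smul_eq_mul]

lemma lintegral_dyadic_split {f g : ℝ → ℝ≥0∞} (hf : Measurable f) (c : ℝ) :
    ∫⁻ y, (f (2 * y) + g (2 * y - c)) = 2⁻¹ * ((∫⁻ y, f y) + ∫⁻ y, g y) := by
  rw [lintegral_add_left (f := fun y => f (2 * y)) (hf.comp (by fun_prop)), lintegral_comp_two_mul f,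
    lintegral_comp_two_mul fun y => g (y - c), lintegral_sub_right_eq_self g c, mul_add]

lemma lintegral_solCount_eq {d : ℤ} (hd : 0 ≤ d) :
    ∫⁻ y, solCount d y = 2⁻¹ * ((∫⁻ y, solCount (d + 1) y) + ∫⁻ y, solCount (d - 1) y) := by
  rw [← lintegral_dyadic_split (measurable_solCount _) ((d:ℝ) + 1)]
  exact lintegral_congr (solCount_eq_add hd)

lemma boxCount_of_neg (n : ℕ) {d : ℤ} (hd : d < 0) (y : ℝ) : boxCount n d y = 0 :=
  le_antisymm ((boxCount_le_solCount n d y).trans_eq (solCount_of_neg hd y)) zero_le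

lemma lintegral_boxCount_le (n : ℕ) {d : ℤ} (hd : -1 ≤ d) :
    ∫⁻ y, boxCount n d y ≤ ENNReal.ofReal (d + 1) := by
  classical
  induction n generalizing d with
  | zero =>
    rcases hd.eq_or_lt with rfl | hd
    · simp [boxCount_of_neg]
    have hd' : (0:ℤ) ≤ d := by omega
    have hdR : (0:ℝ) ≤ d := by exact_mod_cast hd'
    calc ∫⁻ y, boxCount 0 d y ≤ ∫⁻ y, (Icc (0:ℝ) (d + 1)).indicator 1 y := by
          refine lintegral_mono fun y => ?_
          rw [boxCount]
          split_ifs with h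
          · obtain ⟨x, ⟨⟨h0, h1⟩, -⟩, rfl⟩ := h
            rw [indicator_of_mem]
            · rfl
            · have := mul_nonneg hdR h0
              have := mul_le_mul_of_nonneg_left h1.le hdR
              constructor <;> linarith [T_nonneg x, T_le_one x]
          · exact zero_le
      _ = ENNReal.ofReal (d + 1) := by
          rw [lintegral_indicator_one measurableSet_Icc, Real.volume_Icc, sub_zero]
  | succ n ih =>
    rcases hd.eq_or_lt with rfl | hd
    · simp [boxCount_of_neg]
    have hd' : (0:ℤ) ≤ d := by omega
    have hdR : (0:ℝ) ≤ d := by exact_mod_cast hd'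
    have h : ∀ y, boxCount (n + 1) d y =
        boxCount n (d + 1) (2 * y) + boxCount n (d - 1) (2 * y - (d + 1)) := fun y => by
      rw [boxCount, if_neg (not_lt.2 hd')]
    rw [lintegral_congr h, lintegral_dyadic_split (measurable_boxCount _ _)]
    calc _ ≤ 2⁻¹ * (ENNReal.ofReal ((d + 1 : ℤ) + 1) + ENNReal.ofReal ((d - 1 : ℤ) + 1)) := by
          gcongr
          · exact ih (by omega)
          · exact ih (by omega)
      _ = ENNReal.ofReal (d + 1) := by
          rw [← ENNReal.ofReal_add (by push_cast; linarith) (by push_cast; linarith),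
            ← ENNReal.ofReal_ofNat 2, ← ENNReal.ofReal_inv_of_pos two_pos,
            ← ENNReal.ofReal_mul (by norm_num)]
          congr 1
          push_cast
          ring

lemma lintegral_solCount_le {d : ℤ} (hd : -1 ≤ d) :
    ∫⁻ y, solCount d y ≤ ENNReal.ofReal (d + 1) := by
  simp only [solCount_eq_liminf]
  refine (lintegral_liminf_le fun n => measurable_boxCount n d).trans ?_
  refine Filter.liminf_le_of_le (by isBoundedDefault) fun b hb => ?_
  obtain ⟨n, hn⟩ := hb.exists
  exact hn.trans (lintegral_boxCount_le n hd)

lemma le_lintegral_solCount {d : ℤ} (hd : 0 ≤ d) :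
    ENNReal.ofReal d ≤ ∫⁻ y, solCount d y := by
  have hdR : (0:ℝ) ≤ d := by exact_mod_cast hd
  calc ENNReal.ofReal d = ∫⁻ y, (Ico (0:ℝ) d).indicator 1 y := by
        rw [lintegral_indicator_one measurableSet_Ico, Real.volume_Ico, sub_zero]
    _ ≤ ∫⁻ y, solCount d y := by
        refine lintegral_mono fun y => ?_
        by_cases hy : y ∈ Ico (0:ℝ) d
        · obtain ⟨x, hx, rfl⟩ := intermediate_value_Icc zero_le_one
            (continuous_T_add d).continuousOn
            (show y ∈ Icc (T 0 + d * 0) (T 1 + d * 1) by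
              simpa [T_zero, T_one] using Ico_subset_Icc_self hy)
          have hx1 : x ≠ 1 := by
            rintro rfl
            simp [T_one] at hy
          rw [indicator_of_mem hy, solCount, Pi.one_apply, ← ENat.toENNReal_one,
            ENat.toENNReal_le, one_le_encard_iff_nonempty, tiltedSol_nonempty_iff hd]
          exact ⟨x, ⟨hx.1, lt_of_le_of_ne hx.2 hx1⟩, rfl⟩
        · rw [indicator_of_notMem hy]
          exact zero_le

lemma lintegral_solCount_zero : ∫⁻ y, solCount 0 y = 1 := by
  set J : ℤ → ℝ := fun d => (∫⁻ y, solCount d y).toReal with hJ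
  have hfin : ∀ d : ℤ, -1 ≤ d → ∫⁻ y, solCount d y ≠ ⊤ := fun d hd =>
    ((lintegral_solCount_le hd).trans_lt ENNReal.ofReal_lt_top).ne
  have hrec : ∀ d : ℤ, 0 ≤ d → 2 * J d = J (d + 1) + J (d - 1) := by
    intro d hd
    simp only [hJ]
    rw [lintegral_solCount_eq hd, ENNReal.toReal_mul,
      ENNReal.toReal_add (hfin _ (by omega)) (hfin _ (by omega))]
    norm_num
    ring
  have hneg : J (-1) = 0 := by simp [hJ, solCount_of_neg]
  have hlin : ∀ n : ℕ, J n = (n + 1) * J 0 ∧ J (n - 1) = n * J 0 := by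
    intro n
    induction n with
    | zero => simp [hneg]
    | succ n ih =>
      have h := hrec n (by omega)
      push_cast
      rw [add_sub_cancel_right]
      exact ⟨by linarith, ih.1⟩
  have hle : ∀ n : ℕ, J n ≤ n + 1 := by
    intro n
    have := ENNReal.toReal_le_of_le_ofReal (by positivity)
      (lintegral_solCount_le (d := n) (by omega))
    simpa [hJ] using this
  have hge : ∀ n : ℕ, (n:ℝ) ≤ J n := by
    intro n
    have h := le_lintegral_solCount (d := n) (by omega)
    have := (ENNReal.ofReal_le_iff_le_toReal (hfin n (by omega))).1 h
    simpa [hJ] using this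
  have hone : J 0 = 1 := by
    have h0 : J 0 ≤ 1 := by simpa using hle 0
    refine le_antisymm h0 (le_of_forall_pos_lt_add fun ε hε => ?_)
    obtain ⟨n, hn⟩ := exists_nat_gt (1 / ε)
    have h1 := hge n
    rw [(hlin n).1] at h1
    rw [div_lt_iff₀ hε] at hn
    by_contra! hcon
    have : (0:ℝ) ≤ n := n.cast_nonneg
    nlinarith
  rw [← ENNReal.ofReal_toReal (hfin 0 (by omega))]
  simpa [hJ] using congrArg ENNReal.ofReal hone

theorem stmt8 :
    ∫⁻ y in Set.Icc (0:ℝ) (2/3), ((locClasses y).encard : ℝ≥0∞) = 1 := by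
  simp only [encard_locClasses]
  rw [← lintegral_solCount_zero]
  refine setLIntegral_eq_of_support_subset ?_
  intro y hy
  have hne : (tiltedSol 0 y).Nonempty := by
    by_contra h
    rw [not_nonempty_iff_eq_empty] at h
    simp [h] at hy
  obtain ⟨x, -, rfl⟩ := hne
  simpa using And.intro (T_nonneg x) (T_le_two_thirds x)
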